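/- Let S be a peer-to-peer system, k ≥ 1, and msc an MSC. Then msc is a k-synchronous MSC of S in the peer-to-peer sense (i.e., msc = msc(e₀) for some e₀ ∈ asEx(S) and msc is k-synchronous with peer-to-peer causal delivery) if and only if there is a linearisation e = e_1⋯e_n of msc such that (l⃗_0, B_0) ⇝^{e_1}_k ⋯ ⇝^{e_n}_k (l⃗', B') using the peer-to-peer transition relation, for some global state l⃗' and some B' : 𝒫 → 2^𝒫. -/

import Mathlib

set_option autoImplicit false

/-! ## Actions -/

/-- A send or receive action over processes `P` and messages `M`. -/
inductive Act (P M : Type) : Type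
  | send (p q : P) (m : M)
  | recv (p q : P) (m : M)
  deriving DecidableEq

namespace Act
variable {P M : Type}

def isSend : Act P M → Prop
  | send _ _ _ => True
  | recv _ _ _ => False

def isRecv : Act P M → Prop
  | send _ _ _ => False
  | recv _ _ _ => True

/-- The process performing the action: the sender of a send, the receiver of a receive. -/
def proc : Act P M → P
  | send p _ _ => p
  | recv _ q _ => q

end Act

/-- The two kinds of actions of a message exchange: `S`end and `R`eceive. -/
inductive SR : Type
  | S | R
  deriving DecidableEq

/-- Nodes of conflict graphs with summary nodes: ordinary message exchanges
(identified by the position of their send action), summary nodes `λ_p`, and the node `ψ`. -/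
inductive GNode (P : Type) : Type
  | ex (v : ℕ)
  | sum (p : P)
  | psi

/-! ## Matching, message exchanges -/

section Core
variable {P M : Type} [DecidableEq P] [DecidableEq M]

/-- The send at position `i` of `e` is matched by the receive at position `j`:
for some `ℓ`, they are the `ℓ`-th send resp. receive with the given sender/receiver/message. -/
def Matches (e : List (Act P M)) (i j : ℕ) : Prop :=
  i < j ∧ j < e.length ∧ ∃ p q m,
    e[i]? = some (Act.send p q m) ∧ e[j]? = some (Act.recv p q m) ∧
    (e.take (i + 1)).count (Act.send p q m) = (e.take (j + 1)).count (Act.recv p q m)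

/-- Message exchanges (vertices of the conflict graph) are identified with the
positions of their send actions. -/
def IsVertex (e : List (Act P M)) (v : ℕ) : Prop :=
  ∃ p q m, e[v]? = some (Act.send p q m)

def MatchedSend (e : List (Act P M)) (v : ℕ) : Prop := ∃ j, Matches e v j

def UnmatchedSend (e : List (Act P M)) (v : ℕ) : Prop := IsVertex e v ∧ ¬ MatchedSend e v

def SenderIs (e : List (Act P M)) (v : ℕ) (p : P) : Prop := ∃ q m, e[v]? = some (Act.send p q m)

def ReceiverIs (e : List (Act P M)) (v : ℕ) (q : P) : Prop := ∃ p m, e[v]? = some (Act.send p q m)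

/-- A well-formed sequence of actions: every receive is matched. -/
def WFSeq (e : List (Act P M)) : Prop :=
  ∀ j p q m, e[j]? = some (Act.recv p q m) → ∃ i, Matches e i j

end Core

/-! ## MSCs -/

/-- A message sequence chart, presented on `Fin n`. MSCs are identified up to isomorphism. -/
structure MSC (P M : Type) : Type where
  n : ℕ
  label : Fin n → Act P M
  po : Fin n → Fin n → Prop
  src : Fin n → Fin n → Prop

namespace MSC
variable {P M : Type}

/-- The causality order `≺ = (≺_po ∪ ≺_src)⁺`. -/
def prec (m : MSC P M) : Fin m.n → Fin m.n → Prop :=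
  Relation.TransGen (fun i j => m.po i j ∨ m.src i j)

/-- Well-formedness of an MSC: `po` is a strict partial order total on each process's
events, and `src` relates each receive to exactly one send with matching labels,
each send to at most one receive. -/
def WF (m : MSC P M) : Prop :=
  Transitive m.po ∧ (∀ i, ¬ m.po i i) ∧
  (∀ i j, i ≠ j → (m.label i).proc = (m.label j).proc → m.po i j ∨ m.po j i) ∧
  (∀ r, (m.label r).isRecv → ∃! s, m.src s r) ∧
  (∀ s, (m.label s).isSend → ∀ r r', m.src s r → m.src s r' → r = r') ∧
  (∀ s r, m.src s r → ∃ p q v, m.label s = Act.send p q v ∧ m.label r = Act.recv p q v)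

end MSC

section MSCs
variable {P M : Type} [DecidableEq P] [DecidableEq M]

/-- The MSC `msc(e)` of a (well-formed) sequence of actions `e`. -/
def mscOf (e : List (Act P M)) : MSC P M where
  n := e.length
  label i := e.get i
  po i j := (i : ℕ) < (j : ℕ) ∧ (e.get i).proc = (e.get j).proc
  src i j := Matches e i j

/-- `f` is an isomorphism of MSCs. -/
def IsMSCIso (m₁ m₂ : MSC P M) (f : Fin m₁.n ≃ Fin m₂.n) : Prop :=
  (∀ i, m₂.label (f i) = m₁.label i) ∧
  (∀ i j, m₁.po i j ↔ m₂.po (f i) (f j)) ∧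
  (∀ i j, m₁.src i j ↔ m₂.src (f i) (f j))

/-- Isomorphism of MSCs (MSCs are identified up to isomorphism). -/
def MSC.Iso (m₁ m₂ : MSC P M) : Prop := ∃ f, IsMSCIso m₁ m₂ f

/-- `e` is a linearisation of the MSC `m`: `e` is well-formed and `msc(e) = m`. -/
def Linearisation (e : List (Act P M)) (m : MSC P M) : Prop :=
  WFSeq e ∧ MSC.Iso (mscOf e) m

/-- Causal delivery (mailbox): some linearisation is such that any two causally ordered
sends to a same process are either received in the same order, or the later one is unmatched. -/
def CausalDelivery (m : MSC P M) : Prop :=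
  ∃ e : List (Act P M), Linearisation e m ∧
    ∀ (i j : Fin (mscOf e).n) (p p' q : P) (v v' : M),
      (mscOf e).prec i j →
      (mscOf e).label i = Act.send p q v →
      (mscOf e).label j = Act.send p' q v' →
      (¬ MatchedSend e j.val) ∨
        ∃ i' j' : Fin (mscOf e).n,
          Matches e i.val i'.val ∧ Matches e j.val j'.val ∧ (mscOf e).prec i' j'

/-- Peer-to-peer causal delivery: as causal delivery but only for two sends with the
same sender *and* the same receiver. -/
def P2PCausalDelivery (m : MSC P M) : Prop :=
  ∃ e : List (Act P M), Linearisation e m ∧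
    ∀ (i j : Fin (mscOf e).n) (p q : P) (v v' : M),
      (mscOf e).prec i j →
      (mscOf e).label i = Act.send p q v →
      (mscOf e).label j = Act.send p q v' →
      (¬ MatchedSend e j.val) ∨
        ∃ i' j' : Fin (mscOf e).n,
          Matches e i.val i'.val ∧ Matches e j.val j'.val ∧ (mscOf e).prec i' j'

end MSCs

/-! ## Conflict graphs -/

section CG
variable {P M : Type} [DecidableEq P] [DecidableEq M]

/-- The position of the `X`-action of the message exchange `v`. -/
def XAt (e : List (Act P M)) (v : ℕ) : SR → ℕ → Prop
  | SR.S, i => i = v ∧ IsVertex e v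
  | SR.R, i => Matches e v i

/-- The edge `v →_{XY} v'` of the conflict graph of `e`. -/
def CGEdge (e : List (Act P M)) (X Y : SR) (v v' : ℕ) : Prop :=
  ∃ i j, XAt e v X i ∧ XAt e v' Y j ∧ i < j ∧
    ∃ a a' : Act P M, e[i]? = some a ∧ e[j]? = some a' ∧ a.proc = a'.proc

def CGStep (e : List (Act P M)) (v v' : ℕ) : Prop := ∃ X Y, CGEdge e X Y v v'

/-- Reachability `v →* v'` in the conflict graph. -/
def Reach (e : List (Act P M)) : ℕ → ℕ → Prop := Relation.ReflTransGen (CGStep e)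

/-- `U` is a strongly connected component of the conflict graph of `e`. -/
def IsSCC (e : List (Act P M)) (U : Finset ℕ) : Prop :=
  (∀ v ∈ U, IsVertex e v) ∧ ∀ v ∈ U, ∀ v' ∈ U, Reach e v v' ∧ Reach e v' v

/-- Extended edges `v ⊑_{XY} v'` of the extended conflict graph. -/
inductive ExtEdge (e : List (Act P M)) : SR → SR → ℕ → ℕ → Prop
  | base {X Y : SR} {v v' : ℕ} : CGEdge e X Y v v' → ExtEdge e X Y v v'
  | matched {v : ℕ} : MatchedSend e v → ExtEdge e SR.S SR.R v v
  | rr {v v' : ℕ} : CGEdge e SR.R SR.R v v' → ExtEdge e SR.S SR.S v v'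
  | mbox {v v' : ℕ} {q : P} : MatchedSend e v → UnmatchedSend e v' →
      ReceiverIs e v q → ReceiverIs e v' q → ExtEdge e SR.S SR.S v v'
  | trans {X Y Z : SR} {v v' v'' : ℕ} : ExtEdge e X Y v v'' → ExtEdge e Y Z v'' v' →
      ExtEdge e X Z v v'

/-- The process performing the `X`-action of the exchange `v`. -/
def XProcIs (e : List (Act P M)) (v : ℕ) : SR → P → Prop
  | SR.S, r => SenderIs e v r
  | SR.R, r => ∃ j, Matches e v j ∧ ∃ p m, e[j]? = some (Act.recv p r m)

/-- The set of processes involved in the exchange `v`. -/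
def vprocs (e : List (Act P M)) (v : ℕ) : Set P :=
  {r | SenderIs e v r ∨ (MatchedSend e v ∧ ReceiverIs e v r)}

end CG

/-! ## k-exchanges and k-synchronous MSCs -/

section KSync
variable {P M : Type} [DecidableEq P] [DecidableEq M]

/-- A block in `S^{≤k}·R^{≤k}`: at most `k` sends followed by at most `k` receives. -/
def IsBlock (k : ℕ) (b : List (Act P M)) : Prop :=
  ∃ ss rs : List (Act P M), b = ss ++ rs ∧ (∀ a ∈ ss, a.isSend) ∧ (∀ a ∈ rs, a.isRecv) ∧
    ss.length ≤ k ∧ rs.length ≤ k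

def blockStart (es : List (List (Act P M))) (b : ℕ) : ℕ :=
  ((es.take b).map List.length).sum

/-- Positions `i` and `j` of `es.flatten` lie in the same block of `es`. -/
def SameBlock (es : List (List (Act P M))) (i j : ℕ) : Prop :=
  ∃ b, b < es.length ∧ blockStart es b ≤ i ∧ i < blockStart es (b + 1) ∧
    blockStart es b ≤ j ∧ j < blockStart es (b + 1)

/-- An MSC is `k`-synchronous: it satisfies causal delivery and it has a linearisation
divisible into blocks of `S^{≤k}·R^{≤k}` in which every matched pair lies in one block. -/
def KSyncMSC (k : ℕ) (m : MSC P M) : Prop :=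
  CausalDelivery m ∧
  ∃ es : List (List (Act P M)), Linearisation es.flatten m ∧
    (∀ b ∈ es, IsBlock k b) ∧
    ∀ i j, Matches es.flatten i j → SameBlock es i j

/-- A sequence of actions is `k`-synchronizable if its MSC is `k`-synchronous. -/
def KSyncSeq (k : ℕ) (e : List (Act P M)) : Prop := KSyncMSC k (mscOf e)

/-- The peer-to-peer variant of `k`-synchrony. -/
def P2PKSyncMSC (k : ℕ) (m : MSC P M) : Prop :=
  P2PCausalDelivery m ∧
  ∃ es : List (List (Act P M)), Linearisation es.flatten m ∧
    (∀ b ∈ es, IsBlock k b) ∧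
    ∀ i j, Matches es.flatten i j → SameBlock es i j

def P2PKSyncSeq (k : ℕ) (e : List (Act P M)) : Prop := P2PKSyncMSC k (mscOf e)

end KSync

/-! ## Communicating systems (mailbox semantics) -/

/-- A system of communicating finite state machines: a transition relation and an
initial state for each process. -/
structure CSystem (P M St : Type) : Type where
  delta : P → St → Act P M → St → Prop
  init : P → St

section Mailbox
variable {P M St : Type} [DecidableEq P] [DecidableEq M]

/-- One step of the mailbox semantics on configurations (global state, one buffer per process). -/
inductive MStep (S : CSystem P M St) :
    ((P → St) × (P → List M)) → Act P M → ((P → St) × (P → List M)) → Prop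
  | send {l : P → St} {b : P → List M} {p q : P} {m : M} {l' : St} :
      S.delta p (l p) (Act.send p q m) l' →
      MStep S (l, b) (Act.send p q m)
        (Function.update l p l', Function.update b q (b q ++ [m]))
  | recv {l : P → St} {b : P → List M} {p q : P} {m : M} {l' : St} {rest : List M} :
      S.delta q (l q) (Act.recv p q m) l' → b q = m :: rest →
      MStep S (l, b) (Act.recv p q m)
        (Function.update l q l', Function.update b q rest)

/-- Execution of a sequence of actions between two configurations. -/
inductive ExecFrom (S : CSystem P M St) :
    ((P → St) × (P → List M)) → List (Act P M) → ((P → St) × (P → List M)) → Prop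
  | nil {c} : ExecFrom S c [] c
  | cons {c a c' e c''} : MStep S c a c' → ExecFrom S c' e c'' → ExecFrom S c (a :: e) c''

def initConf (S : CSystem P M St) : (P → St) × (P → List M) := (S.init, fun _ => [])

/-- `asEx(S)`: `e` is an (asynchronous) execution of `S`. -/
def asEx (S : CSystem P M St) (e : List (Act P M)) : Prop :=
  ∃ c, ExecFrom S (initConf S) e c

/-- `S` is `k`-synchronizable: every execution of `S` is `k`-synchronizable. -/
def KSynchronizable (k : ℕ) (S : CSystem P M St) : Prop :=
  ∀ e, asEx S e → KSyncSeq k e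

end Mailbox

/-! ## The instrumented system -/

abbrev IProc (P : Type) : Type := Option P
abbrev IMsg (P M : Type) : Type := Sum M (P × M)
abbrev ISt (P M St : Type) : Type := Sum St (Sum (P × M) Bool)
abbrev IAct (P M : Type) : Type := Act (IProc P) (IMsg P M)

def liftAct {P M : Type} : Act P M → IAct P M
  | Act.send p q m => Act.send (some p) (some q) (Sum.inl m)
  | Act.recv p q m => Act.recv (some p) (some q) (Sum.inl m)

/-- Transitions of the instrumented system `S'`: the original transitions, deviations
of sends/receives through the fresh process `π` (= `none`), and the behaviour of `π`. -/
inductive IDelta {P M St : Type} (S : CSystem P M St) :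
    IProc P → ISt P M St → IAct P M → ISt P M St → Prop
  | origSend {p q : P} {m : M} {s s' : St} :
      S.delta p s (Act.send p q m) s' →
      IDelta S (some p) (Sum.inl s) (Act.send (some p) (some q) (Sum.inl m)) (Sum.inl s')
  | origRecv {p q : P} {m : M} {s s' : St} :
      S.delta q s (Act.recv p q m) s' →
      IDelta S (some q) (Sum.inl s) (Act.recv (some p) (some q) (Sum.inl m)) (Sum.inl s')
  | devSend {p q : P} {m : M} {s s' : St} :
      S.delta p s (Act.send p q m) s' →
      IDelta S (some p) (Sum.inl s) (Act.send (some p) none (Sum.inr (q, m))) (Sum.inl s')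
  | devRecv {p q : P} {m : M} {s s' : St} :
      S.delta q s (Act.recv p q m) s' →
      IDelta S (some q) (Sum.inl s) (Act.recv none (some q) (Sum.inl m)) (Sum.inl s')
  | piRecv {p q : P} {m : M} :
      IDelta S none (Sum.inr (Sum.inr false)) (Act.recv (some p) none (Sum.inr (q, m)))
        (Sum.inr (Sum.inl (q, m)))
  | piSend {q : P} {m : M} :
      IDelta S none (Sum.inr (Sum.inl (q, m))) (Act.send none (some q) (Sum.inl m))
        (Sum.inr (Sum.inr true))

/-- The instrumented system `S'`. -/
def instrumented {P M St : Type} (S : CSystem P M St) :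
    CSystem (IProc P) (IMsg P M) (ISt P M St) where
  delta := IDelta S
  init := fun p => match p with
    | some p => Sum.inl (S.init p)
    | none => Sum.inr (Sum.inr false)

section Deviate
variable {P M St : Type} [DecidableEq P] [DecidableEq M]

/-- `e'` is obtained from `ec = e₁·send(p,q,m)·e₂·rec(p,q,m)` (the final receive being
matched by the exhibited send) by deviating that message exchange through `π`. -/
def Deviate (e' : List (IAct P M)) (ec : List (Act P M)) : Prop :=
  ∃ (e₁ e₂ : List (Act P M)) (p q : P) (m : M),
    ec = e₁ ++ [Act.send p q m] ++ e₂ ++ [Act.recv p q m] ∧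
    Matches ec e₁.length (ec.length - 1) ∧
    e' = e₁.map liftAct ++
      [Act.send (some p) none (Sum.inr (q, m)), Act.recv (some p) none (Sum.inr (q, m))] ++
      e₂.map liftAct ++
      [Act.send none (some q) (Sum.inl m), Act.recv none (some q) (Sum.inl m)]

/-- A (k-synchronizable) execution `e'` of `S'` is feasible if it is the deviation of an
execution of `S`. -/
def Feasible (S : CSystem P M St) (e' : List (IAct P M)) : Prop :=
  ∃ ec, asEx S ec ∧ Deviate e' ec

/-- A feasible execution `e' = deviate(e·r)` is bad if `e·r` is not `k`-synchronizable. -/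
def BadExec (k : ℕ) (S : CSystem P M St) (e' : List (IAct P M)) : Prop :=
  ∃ ec, asEx S ec ∧ Deviate e' ec ∧ ¬ KSyncSeq k ec

end Deviate

/-! ## Conflict graphs with summary nodes and the k-exchange transition relation -/

section Summary
variable {P M : Type} [DecidableEq P] [DecidableEq M]

/-- Select by `X ∈ {S,R}` the corresponding component of a pair of sets of processes. -/
def selC {P : Type} : SR → Set P × Set P → Set P
  | SR.S, c => c.1
  | SR.R, c => c.2

/-- Edges of the conflict graph `CG(e,B,Cπ)` with summary nodes `λ_p` and `ψ`.
(For the graph `CG(e,B)` without `ψ` take `Cπ = (∅,∅)`, which makes `ψ` isolated.) -/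
inductive SCGEdge (e : List (Act P M)) (B : P → Set P × Set P) (Cpi : Set P × Set P) :
    SR → SR → GNode P → GNode P → Prop
  | base {X Y : SR} {v v' : ℕ} :
      CGEdge e X Y v v' → SCGEdge e B Cpi X Y (GNode.ex v) (GNode.ex v')
  | sum1 {p : P} {X : SR} {v : ℕ} {r : P} :
      XProcIs e v X r → r ∈ (B p).1 → SCGEdge e B Cpi SR.S X (GNode.sum p) (GNode.ex v)
  | sum2 {p : P} {X : SR} {v : ℕ} {r : P} :
      XProcIs e v X r → r ∈ (B p).2 → MatchedSend e v →
      SCGEdge e B Cpi SR.S SR.S (GNode.sum p) (GNode.ex v)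
  | sum3 {p : P} {v : ℕ} {q : P} :
      ReceiverIs e v q → q ∈ (B p).2 → UnmatchedSend e v →
      SCGEdge e B Cpi SR.S SR.S (GNode.sum p) (GNode.ex v)
  | sum4 {p : P} {v : ℕ} :
      ReceiverIs e v p → MatchedSend e v →
      SCGEdge e B Cpi SR.S SR.S (GNode.ex v) (GNode.sum p)
  | sum5 {q p : P} :
      p ∈ (B q).2 → SCGEdge e B Cpi SR.S SR.S (GNode.sum q) (GNode.sum p)
  | psi1 {X : SR} {v : ℕ} {r : P} :
      XProcIs e v X r → r ∈ Cpi.1 → SCGEdge e B Cpi SR.S X GNode.psi (GNode.ex v)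
  | psi2 {X : SR} {v : ℕ} {r : P} :
      XProcIs e v X r → r ∈ Cpi.2 → MatchedSend e v →
      SCGEdge e B Cpi SR.S SR.S GNode.psi (GNode.ex v)
  | psi3 {v : ℕ} {q : P} :
      ReceiverIs e v q → q ∈ Cpi.2 → UnmatchedSend e v →
      SCGEdge e B Cpi SR.S SR.S GNode.psi (GNode.ex v)
  | psi4 {p : P} :
      p ∈ Cpi.2 → SCGEdge e B Cpi SR.S SR.S GNode.psi (GNode.sum p)

/-- Extended edges of the conflict graph with summary nodes. -/
inductive SExtEdge (e : List (Act P M)) (B : P → Set P × Set P) (Cpi : Set P × Set P) :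
    SR → SR → GNode P → GNode P → Prop
  | base {X Y : SR} {n n' : GNode P} :
      SCGEdge e B Cpi X Y n n' → SExtEdge e B Cpi X Y n n'
  | matched {v : ℕ} :
      MatchedSend e v → SExtEdge e B Cpi SR.S SR.R (GNode.ex v) (GNode.ex v)
  | rr {n n' : GNode P} :
      SCGEdge e B Cpi SR.R SR.R n n' → SExtEdge e B Cpi SR.S SR.S n n'
  | mbox {v v' : ℕ} {q : P} :
      MatchedSend e v → UnmatchedSend e v' → ReceiverIs e v q → ReceiverIs e v' q →
      SExtEdge e B Cpi SR.S SR.S (GNode.ex v) (GNode.ex v')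
  | trans {X Y Z : SR} {n n' n'' : GNode P} :
      SExtEdge e B Cpi X Y n n'' → SExtEdge e B Cpi Y Z n'' n' → SExtEdge e B Cpi X Z n n'

/-- The nodes `Unm_p`: the summary node `λ_p` together with the unmatched exchanges of `e`
with receiver `p`. -/
def UnmNode (e : List (Act P M)) (p : P) : GNode P → Prop
  | GNode.ex v => UnmatchedSend e v ∧ ReceiverIs e v p
  | GNode.sum q => q = p
  | GNode.psi => False

/-- The updated component `C'_{X,p}` of `B` after the k-exchange `e`. -/
def nextC (e : List (Act P M)) (B : P → Set P × Set P) (X : SR) (p : P) : Set P :=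
  selC X (B p)
  ∪ {s | X = SR.S ∧ ∃ v, UnmatchedSend e v ∧ ReceiverIs e v p ∧ SenderIs e v s}
  ∪ {r | ∃ n v', UnmNode e p n ∧
      SExtEdge e B ((∅, ∅) : Set P × Set P) SR.S SR.S n (GNode.ex v') ∧ XProcIs e v' X r}
  ∪ {r | ∃ q n, ((∃ v, n = GNode.ex v ∧ ReceiverIs e v p) ∨ n = GNode.sum p) ∧
      SExtEdge e B ((∅, ∅) : Set P × Set P) SR.S SR.S n (GNode.sum q) ∧ r ∈ selC X (B q)}

/-- The updated component `C^π_X'` after the k-exchange `e`, where `piP` is the process `π`. -/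
def nextCpi (piP : P) (e : List (Act P M)) (B : P → Set P × Set P) (Cpi : Set P × Set P)
    (X : SR) : Set P :=
  selC X Cpi
  ∪ {s | X = SR.S ∧ ∃ v, ReceiverIs e v piP ∧ SenderIs e v s}
  ∪ {r | ∃ n v', ((∃ v, n = GNode.ex v ∧ ReceiverIs e v piP) ∨ n = GNode.psi) ∧
      SExtEdge e B Cpi SR.S SR.S n (GNode.ex v') ∧ XProcIs e v' X r}
  ∪ {r | ∃ q n, ((∃ v, n = GNode.ex v ∧ ReceiverIs e v piP) ∨ n = GNode.psi) ∧
      SExtEdge e B Cpi SR.S SR.S n (GNode.sum q) ∧ r ∈ selC X (B q)}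

end Summary

section KExchange
variable {P M St : Type} [DecidableEq P] [DecidableEq M]

/-- The transition relation `(l⃗,B) ⇝^e_k (l⃗',B')` on abstract configurations. -/
def KExch (S : CSystem P M St) (k : ℕ) (e : List (Act P M))
    (c c' : (P → St) × (P → Set P × Set P)) : Prop :=
  (∃ ss rs : List (Act P M), e = ss ++ rs ∧ (∀ a ∈ ss, a.isSend) ∧ (∀ a ∈ rs, a.isRecv) ∧
    rs.length ≤ ss.length ∧ ss.length ≤ k) ∧
  (∃ buf, ExecFrom S (c.1, fun _ => []) e (c'.1, buf)) ∧
  (∀ p X, selC X (c'.2 p) = nextC e c.2 X p) ∧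
  ∀ p, p ∉ selC SR.R (c'.2 p)

/-- Iterated `⇝^{e_1}_k ⋯ ⇝^{e_n}_k`. -/
inductive KChain (S : CSystem P M St) (k : ℕ) :
    ((P → St) × (P → Set P × Set P)) → List (List (Act P M)) →
    ((P → St) × (P → Set P × Set P)) → Prop
  | nil {c} : KChain S k c [] c
  | cons {c e c' es c''} :
      KExch S k e c c' → KChain S k c' es c'' → KChain S k c (e :: es) c''

end KExchange

/-! ## The transition relation recognising feasible executions -/

/-- Abstract configurations `(l⃗, B, C⃗^π, dest)` for the instrumented system. -/
structure PiAConf (P M St : Type) : Type where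
  gs : IProc P → ISt P M St
  B : IProc P → Set (IProc P) × Set (IProc P)
  Cpi : Set (IProc P) × Set (IProc P)
  dest : Option P

section PiTrans
variable {P M St : Type} [DecidableEq P] [DecidableEq M]

/-- The transition relation `(l⃗,B,C^π_S,C^π_R,dest) ⇝^e_k (l⃗',B',C^π_S',C^π_R',dest')`. -/
def PiTrans (S : CSystem P M St) (k : ℕ) (e : List (IAct P M))
    (c c' : PiAConf P M St) : Prop :=
  KExch (instrumented S) k e (c.gs, c.B) (c'.gs, c'.B) ∧
  (∀ v, ¬ SenderIs e v (none : IProc P)) ∧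
  (∀ v v', ReceiverIs e v (none : IProc P) → ReceiverIs e v' (none : IProc P) →
    v = v' ∧ c.dest = none) ∧
  ((∃ (d : ℕ) (p q : P) (m : M),
      e[d]? = some (Act.send (some p) none (Sum.inr (q, m))) ∧ c'.dest = some q) ∨
   ((¬ ∃ (d : ℕ) (p q : P) (m : M),
      e[d]? = some (Act.send (some p) none (Sum.inr (q, m)))) ∧ c'.dest = c.dest)) ∧
  (c.dest ≠ none → c'.dest = c.dest) ∧
  (∀ X, selC X c'.Cpi = nextCpi (none : IProc P) e c.B c.Cpi X) ∧
  ∀ q : P, c'.dest = some q → (some q : IProc P) ∉ c'.Cpi.2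

inductive PiChain (S : CSystem P M St) (k : ℕ) :
    PiAConf P M St → List (List (IAct P M)) → PiAConf P M St → Prop
  | nil {c} : PiChain S k c [] c
  | cons {c e c' es c''} :
      PiTrans S k e c c' → PiChain S k c' es c'' → PiChain S k c (e :: es) c''

/-- The initial abstract configuration `(l⃗_0, B_0, (∅,∅), ⊥)`. -/
def initPi (S : CSystem P M St) : PiAConf P M St :=
  ⟨(instrumented S).init, fun _ => (∅, ∅), (∅, ∅), none⟩

end PiTrans

/-! ## The transition relation recognising bad executions -/

/-- Abstract configurations `(P, Q, cnt, sawRS, lastIsRec)`. -/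
structure BVConf (P : Type) : Type where
  Ps : Set P
  Qs : Set P
  cnt : ℕ
  sawRS : Bool
  lir : P → Bool

section BV
variable {P M : Type} [DecidableEq P] [DecidableEq M]

/-- `succ_e(Ps)`: vertices reachable from a vertex involving a process of `Ps`. -/
def succSet (e : List (Act P M)) (Ps : Set P) : Set ℕ :=
  {v | IsVertex e v ∧ ∃ u, IsVertex e u ∧ (∃ r ∈ vprocs e u, r ∈ Ps) ∧ Reach e u v}

/-- `pred_e(Qs)`: vertices co-reachable from a vertex involving a process of `Qs`. -/
def predSet (e : List (Act P M)) (Qs : Set P) : Set ℕ :=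
  {v | IsVertex e v ∧ ∃ u, IsVertex e u ∧ (∃ r ∈ vprocs e u, r ∈ Qs) ∧ Reach e v u}

/-- The transition relation of Fig. 9, `piP` being the process `π`. -/
def BTrans (piP : P) (k : ℕ) (e : List (Act P M)) (c c' : BVConf P) : Prop :=
  c'.Ps = {r | ∃ v ∈ succSet e c.Ps, r ∈ vprocs e v} ∧
  c.Qs = {r | ∃ v ∈ predSet e c'.Qs, r ∈ vprocs e v} ∧
  c'.cnt = min (k + 2) (c.cnt + (succSet e c.Ps ∩ predSet e c'.Qs).ncard) ∧
  (∀ q : P, c'.lir q = true ↔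
    ((∃ v ∈ succSet e c.Ps ∩ predSet e c'.Qs, MatchedSend e v ∧ ReceiverIs e v q) ∨
     (c.lir q = true ∧ ¬ ∃ v, IsVertex e v ∧ SenderIs e v q))) ∧
  (c'.sawRS = true ↔
    (c.sawRS = true ∨ ∃ v ∈ succSet e c.Ps ∩ predSet e c'.Qs, ∃ p : P, p ≠ piP ∧
      SenderIs e v p ∧ c.lir p = true ∧ p ∈ c.Ps ∧ p ∈ c.Qs))

inductive BChain (piP : P) (k : ℕ) :
    BVConf P → List (List (Act P M)) → BVConf P → Prop
  | nil {c} : BChain piP k c [] c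
  | cons {c e c' es c''} :
      BTrans piP k e c c' → BChain piP k c' es c'' → BChain piP k c (e :: es) c''

end BV

/-! ## Peer-to-peer systems -/

section P2P
variable {P M St : Type} [DecidableEq P] [DecidableEq M]

/-- One step of the peer-to-peer semantics (one buffer per ordered pair of processes). -/
inductive P2PStep (S : CSystem P M St) :
    ((P → St) × (P → P → List M)) → Act P M → ((P → St) × (P → P → List M)) → Prop
  | send {l : P → St} {b : P → P → List M} {p q : P} {m : M} {l' : St} :
      S.delta p (l p) (Act.send p q m) l' →
      P2PStep S (l, b) (Act.send p q m)
        (Function.update l p l',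
          fun p' q' => if p' = p ∧ q' = q then b p q ++ [m] else b p' q')
  | recv {l : P → St} {b : P → P → List M} {p q : P} {m : M} {l' : St} {rest : List M} :
      S.delta q (l q) (Act.recv p q m) l' → b p q = m :: rest →
      P2PStep S (l, b) (Act.recv p q m)
        (Function.update l q l',
          fun p' q' => if p' = p ∧ q' = q then rest else b p' q')

inductive P2PExecFrom (S : CSystem P M St) :
    ((P → St) × (P → P → List M)) → List (Act P M) → ((P → St) × (P → P → List M)) → Prop
  | nil {c} : P2PExecFrom S c [] c
  | cons {c a c' e c''} :
      P2PStep S c a c' → P2PExecFrom S c' e c'' → P2PExecFrom S c (a :: e) c''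

def p2pInitConf (S : CSystem P M St) : (P → St) × (P → P → List M) :=
  (S.init, fun _ _ => [])

/-- `e` is a peer-to-peer execution of `S`. -/
def p2pAsEx (S : CSystem P M St) (e : List (Act P M)) : Prop :=
  ∃ c, P2PExecFrom S (p2pInitConf S) e c

/-- `S` is `k`-synchronizable as a peer-to-peer system. -/
def P2PKSynchronizable (k : ℕ) (S : CSystem P M St) : Prop :=
  ∀ e, p2pAsEx S e → P2PKSyncSeq k e

/-- Feasibility for peer-to-peer systems. -/
def P2PFeasible (S : CSystem P M St) (e' : List (IAct P M)) : Prop :=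
  ∃ ec, p2pAsEx S ec ∧ Deviate e' ec

/-- Badness for peer-to-peer systems. -/
def P2PBadExec (k : ℕ) (S : CSystem P M St) (e' : List (IAct P M)) : Prop :=
  ∃ ec, p2pAsEx S ec ∧ Deviate e' ec ∧ ¬ P2PKSyncSeq k ec

/-- The staged update `B_1, …, B_{m+1}` of the forbidden-senders map along `e`. -/
def stageB (e : List (Act P M)) (B : P → Set P) : ℕ → P → Set P
  | 0 => B
  | (i + 1) => fun q =>
      stageB e B i q ∪ {p | ∃ m, e[i]? = some (Act.send p q m) ∧ ¬ MatchedSend e i}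

/-- The peer-to-peer transition relation `(l⃗,B) ⇝^e_k (l⃗',B')`. -/
def P2PKExch (S : CSystem P M St) (k : ℕ) (e : List (Act P M))
    (c c' : (P → St) × (P → Set P)) : Prop :=
  (∃ ss rs : List (Act P M), e = ss ++ rs ∧ (∀ a ∈ ss, a.isSend) ∧ (∀ a ∈ rs, a.isRecv) ∧
    rs.length ≤ ss.length ∧ ss.length ≤ k) ∧
  (∃ buf, P2PExecFrom S (c.1, fun _ _ => []) e (c'.1, buf)) ∧
  c'.2 = stageB e c.2 e.length ∧
  ∀ i p q m, e[i]? = some (Act.send p q m) → MatchedSend e i → p ∉ stageB e c.2 i q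

inductive P2PKChain (S : CSystem P M St) (k : ℕ) :
    ((P → St) × (P → Set P)) → List (List (Act P M)) → ((P → St) × (P → Set P)) → Prop
  | nil {c} : P2PKChain S k c [] c
  | cons {c e c' es c''} :
      P2PKExch S k e c c' → P2PKChain S k c' es c'' → P2PKChain S k c (e :: es) c''

end P2P

/-- Abstract configurations `(l⃗, B, exp, dest)` for the peer-to-peer instrumented system. -/
structure P2PPiConf (P M St : Type) : Type where
  gs : IProc P → ISt P M St
  B : IProc P → Set (IProc P)
  exp : Option P
  dest : Option P

section P2PPi
variable {P M St : Type} [DecidableEq P] [DecidableEq M]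

/-- The peer-to-peer transition relation `(l⃗,B,exp,dest) ⇝^e_k (l⃗',B',exp',dest')`. -/
def P2PPiTrans (S : CSystem P M St) (k : ℕ) (e : List (IAct P M))
    (c c' : P2PPiConf P M St) : Prop :=
  P2PKExch (instrumented S) k e (c.gs, c.B) (c'.gs, c'.B) ∧
  (∀ v, ¬ SenderIs e v (none : IProc P)) ∧
  (∀ v v', ReceiverIs e v (none : IProc P) → ReceiverIs e v' (none : IProc P) →
    v = v' ∧ c.dest = none) ∧
  ((∃ (d : ℕ) (p q : P) (m : M),
      e[d]? = some (Act.send (some p) none (Sum.inr (q, m))) ∧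
      c'.exp = some p ∧ c'.dest = some q ∧
      (c.dest = none → ∀ v, d < v → MatchedSend e v →
        ¬ (SenderIs e v (some p) ∧ ReceiverIs e v (some q)))) ∨
   ((¬ ∃ (d : ℕ) (p q : P) (m : M),
      e[d]? = some (Act.send (some p) none (Sum.inr (q, m)))) ∧
      c'.exp = c.exp ∧ c'.dest = c.dest)) ∧
  (c.dest ≠ none → c'.dest = c.dest ∧ c'.exp = c.exp) ∧
  (∀ p q : P, c'.exp = some p → c'.dest = some q → c.dest ≠ none →
    ∀ v, MatchedSend e v → ¬ (SenderIs e v (some p) ∧ ReceiverIs e v (some q)))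

inductive P2PPiChain (S : CSystem P M St) (k : ℕ) :
    P2PPiConf P M St → List (List (IAct P M)) → P2PPiConf P M St → Prop
  | nil {c} : P2PPiChain S k c [] c
  | cons {c e c' es c''} :
      P2PPiTrans S k e c c' → P2PPiChain S k c' es c'' → P2PPiChain S k c (e :: es) c''

/-- The initial abstract configuration `(l⃗_0, B_0, ⊥, ⊥)`. -/
def initP2PPi (S : CSystem P M St) : P2PPiConf P M St :=
  ⟨(instrumented S).init, fun _ => ∅, none, none⟩

end P2PPi


set_option linter.unusedSectionVars false

/-! ## Channel contents -/

section Channels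
variable {P M : Type} [DecidableEq P] [DecidableEq M]

/-- The message sent from `p` to `q` by an action, if any. -/
def sentMsg (p q : P) : Act P M → Option M
  | Act.send p' q' m => if p' = p ∧ q' = q then some m else none
  | Act.recv _ _ _ => none

/-- The message received by `q` from `p` by an action, if any. -/
def rcvdMsg (p q : P) : Act P M → Option M
  | Act.send _ _ _ => none
  | Act.recv p' q' m => if p' = p ∧ q' = q then some m else none

/-- The messages sent from `p` to `q` along `e`. -/
def sent (p q : P) (e : List (Act P M)) : List M := e.filterMap (sentMsg p q)

/-- The messages received by `q` from `p` along `e`. -/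
def rcvd (p q : P) (e : List (Act P M)) : List M := e.filterMap (rcvdMsg p q)

/-- Along every prefix of `e`, every channel delivers a prefix of what was sent through it. -/
def IsFifo (e : List (Act P M)) : Prop :=
  ∀ (p q : P) (n : ℕ), rcvd p q (e.take n) <+: sent p q (e.take n)

theorem sentMsg_eq_some {p q : P} {a : Act P M} {m : M} :
    sentMsg p q a = some m ↔ a = Act.send p q m := by
  cases a <;> simp [sentMsg]; grind

theorem rcvdMsg_eq_some {p q : P} {a : Act P M} {m : M} :
    rcvdMsg p q a = some m ↔ a = Act.recv p q m := by
  cases a <;> simp [rcvdMsg]; grind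

theorem count_filterMap_eq {α β : Type} [DecidableEq α] [DecidableEq β] {g : α → Option β}
    {a : α} {b : β} (h : ∀ x, g x = some b ↔ x = a) (l : List α) :
    (l.filterMap g).count b = l.count a := by
  induction l with
  | nil => simp
  | cons x l ih =>
    by_cases hx : x = a
    · subst hx
      rw [List.filterMap_cons_some ((h x).2 rfl)]
      simp [ih]
    · rw [List.count_cons_of_ne hx]
      cases hg : g x with
      | none => rw [List.filterMap_cons_none hg, ih]
      | some y =>
        rw [List.filterMap_cons_some hg, List.count_cons_of_ne, ih]
        rintro rfl
        exact hx ((h x).1 hg)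

theorem count_sent (p q : P) (m : M) (e : List (Act P M)) :
    (sent p q e).count m = e.count (Act.send p q m) :=
  count_filterMap_eq (fun _ => sentMsg_eq_some) e

theorem count_rcvd (p q : P) (m : M) (e : List (Act P M)) :
    (rcvd p q e).count m = e.count (Act.recv p q m) :=
  count_filterMap_eq (fun _ => rcvdMsg_eq_some) e

theorem filterMap_take_succ {α β : Type} {g : α → Option β} {l : List α} {i : ℕ} {a : α} {b : β}
    (hi : l[i]? = some a) (hg : g a = some b) :
    (l.take (i + 1)).filterMap g = (l.take i).filterMap g ++ [b] := by
  rw [List.take_add_one, hi]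
  simp [List.filterMap_append, hg]

theorem filterMap_take_mono {α β : Type} (g : α → Option β) (l : List α) {i j : ℕ}
    (h : i ≤ j) : (l.take i).filterMap g <+: (l.take j).filterMap g :=
  (List.take_prefix_take_left h).filterMap g

theorem exists_index_filterMap {α β : Type} (g : α → Option β) (l : List α) {n t : ℕ}
    (h : n < ((l.take t).filterMap g).length) :
    ∃ i < t, ∃ b, (∃ a, l[i]? = some a ∧ g a = some b) ∧
      ((l.take i).filterMap g).length = n := by
  induction t with
  | zero => simp at h
  | succ t ih =>
    by_cases h' : n < ((l.take t).filterMap g).length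
    · obtain ⟨i, hi, r⟩ := ih h'
      exact ⟨i, by omega, r⟩
    · rw [List.take_add_one] at h
      cases hl : l[t]? with
      | none => simp [hl] at h; omega
      | some a =>
        cases hg : g a with
        | none => simp [hl, hg] at h; omega
        | some b =>
          refine ⟨t, by omega, b, ⟨a, hl, hg⟩, ?_⟩
          simp [hl, hg] at h
          omega

theorem sent_take_succ {p q : P} {m : M} {e : List (Act P M)} {i : ℕ}
    (h : e[i]? = some (Act.send p q m)) :
    sent p q (e.take (i + 1)) = sent p q (e.take i) ++ [m] :=
  filterMap_take_succ h (sentMsg_eq_some.2 rfl)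

theorem rcvd_take_succ {p q : P} {m : M} {e : List (Act P M)} {i : ℕ}
    (h : e[i]? = some (Act.recv p q m)) :
    rcvd p q (e.take (i + 1)) = rcvd p q (e.take i) ++ [m] :=
  filterMap_take_succ h (rcvdMsg_eq_some.2 rfl)

theorem sent_take_length_mono (p q : P) (e : List (Act P M)) {i j : ℕ} (h : i ≤ j) :
    (sent p q (e.take i)).length ≤ (sent p q (e.take j)).length :=
  (filterMap_take_mono _ e h).length_le

theorem rcvd_take_length_mono (p q : P) (e : List (Act P M)) {i j : ℕ} (h : i ≤ j) :
    (rcvd p q (e.take i)).length ≤ (rcvd p q (e.take j)).length :=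
  (filterMap_take_mono _ e h).length_le

theorem sent_take_length_lt {p q : P} {m : M} {e : List (Act P M)} {i j : ℕ}
    (h : e[i]? = some (Act.send p q m)) (hij : i < j) :
    (sent p q (e.take i)).length < (sent p q (e.take j)).length := by
  have := sent_take_length_mono p q e (Nat.succ_le_of_lt hij)
  rw [Nat.succ_eq_add_one, sent_take_succ h] at this
  simp at this
  omega

theorem rcvd_take_length_lt {p q : P} {m : M} {e : List (Act P M)} {i j : ℕ}
    (h : e[i]? = some (Act.recv p q m)) (hij : i < j) :
    (rcvd p q (e.take i)).length < (rcvd p q (e.take j)).length := by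
  have := rcvd_take_length_mono p q e (Nat.succ_le_of_lt hij)
  rw [Nat.succ_eq_add_one, rcvd_take_succ h] at this
  simp at this
  omega

theorem exists_send_at {p q : P} {e : List (Act P M)} {n t : ℕ}
    (h : n < (sent p q (e.take t)).length) :
    ∃ i < t, ∃ m, e[i]? = some (Act.send p q m) ∧ (sent p q (e.take i)).length = n := by
  obtain ⟨i, hi, m, ⟨a, ha, hg⟩, hn⟩ := exists_index_filterMap _ e h
  exact ⟨i, hi, m, sentMsg_eq_some.1 hg ▸ ha, hn⟩

theorem exists_recv_at {p q : P} {e : List (Act P M)} {n t : ℕ}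
    (h : n < (rcvd p q (e.take t)).length) :
    ∃ i < t, ∃ m, e[i]? = some (Act.recv p q m) ∧ (rcvd p q (e.take i)).length = n := by
  obtain ⟨i, hi, m, ⟨a, ha, hg⟩, hn⟩ := exists_index_filterMap _ e h
  exact ⟨i, hi, m, rcvdMsg_eq_some.1 hg ▸ ha, hn⟩

/-! ## Matching -/

theorem count_take_lt {α : Type} [DecidableEq α] {l : List α} {a : α} {i j : ℕ}
    (hj : l[j]? = some a) (hij : i < j) :
    (l.take (i + 1)).count a < (l.take (j + 1)).count a := by
  have h1 : (l.take (j + 1)).count a = (l.take j).count a + 1 := by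
    rw [List.take_add_one, hj]; simp
  have h2 : (l.take (i + 1)).count a ≤ (l.take j).count a :=
    (List.take_prefix_take_left hij).sublist.count_le a
  omega

theorem eq_of_count_take_eq {α : Type} [DecidableEq α] {l : List α} {a : α} {i j : ℕ}
    (hi : l[i]? = some a) (hj : l[j]? = some a)
    (h : (l.take (i + 1)).count a = (l.take (j + 1)).count a) : i = j := by
  rcases lt_trichotomy i j with hij | hij | hij
  · have := count_take_lt hj hij; omega
  · exact hij
  · have := count_take_lt hi hij; omega

/-- The last occurrence of `a` before position `n`. -/
theorem exists_last_count {α : Type} [DecidableEq α] {l : List α} {a : α} {n : ℕ}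
    (h : 0 < (l.take n).count a) :
    ∃ i < n, l[i]? = some a ∧ (l.take (i + 1)).count a = (l.take n).count a := by
  induction n with
  | zero => simp at h
  | succ n ih =>
    by_cases hn : l[n]? = some a
    · exact ⟨n, by omega, hn, rfl⟩
    · have h' : (l.take (n + 1)).count a = (l.take n).count a := by
        rw [List.take_add_one]
        cases hl : l[n]? with
        | none => simp
        | some b =>
          rw [hl] at hn
          have : b ≠ a := fun h => hn (by rw [h])
          simp [List.count_append, this]
      rw [h'] at h ⊢
      obtain ⟨i, hi, r⟩ := ih h
      exact ⟨i, by omega, r⟩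

theorem Matches.eq_right {e : List (Act P M)} {i j j' : ℕ} (h : Matches e i j)
    (h' : Matches e i j') : j = j' := by
  obtain ⟨_, _, p, q, m, hi, hj, hc⟩ := h
  obtain ⟨_, _, p', q', m', hi', hj', hc'⟩ := h'
  rw [hi] at hi'
  obtain ⟨rfl, rfl, rfl⟩ : p = p' ∧ q = q' ∧ m = m' := by simpa using hi'
  exact eq_of_count_take_eq hj hj' (by rw [← hc, hc'])

theorem Matches.eq_left {e : List (Act P M)} {i i' j : ℕ} (h : Matches e i j)
    (h' : Matches e i' j) : i = i' := by
  obtain ⟨_, _, p, q, m, hi, hj, hc⟩ := h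
  obtain ⟨_, _, p', q', m', hi', hj', hc'⟩ := h'
  rw [hj] at hj'
  obtain ⟨rfl, rfl, rfl⟩ : p = p' ∧ q = q' ∧ m = m' := by simpa using hj'
  exact eq_of_count_take_eq hi hi' (by rw [hc, hc'])

theorem Matches.recv_of_send {e : List (Act P M)} {i j : ℕ} {p q : P} {m : M}
    (h : Matches e i j) (hi : e[i]? = some (Act.send p q m)) :
    e[j]? = some (Act.recv p q m) := by
  obtain ⟨_, _, p', q', m', hi', hj, -⟩ := h
  rw [hi] at hi'
  obtain ⟨rfl, rfl, rfl⟩ : p = p' ∧ q = q' ∧ m = m' := by simpa using hi'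
  exact hj

theorem Matches.send_of_recv {e : List (Act P M)} {i j : ℕ} {p q : P} {m : M}
    (h : Matches e i j) (hj : e[j]? = some (Act.recv p q m)) :
    e[i]? = some (Act.send p q m) := by
  obtain ⟨_, _, p', q', m', hi', hj', -⟩ := h
  rw [hj] at hj'
  obtain ⟨rfl, rfl, rfl⟩ : p = p' ∧ q = q' ∧ m = m' := by simpa using hj'
  exact hi'

theorem IsFifo.matches_of_length_eq {e : List (Act P M)} (he : IsFifo e) {i j : ℕ} {p q : P}
    {m m' : M} (hi : e[i]? = some (Act.send p q m)) (hj : e[j]? = some (Act.recv p q m'))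
    (h : (sent p q (e.take i)).length = (rcvd p q (e.take j)).length) : Matches e i j := by
  have hfj := he p q (j + 1)
  have hij : i < j := by
    have hne : i ≠ j := by rintro rfl; rw [hi] at hj; simp at hj
    by_contra hc
    have h1 := sent_take_length_mono p q e (show j + 1 ≤ i by omega)
    have h2 := hfj.length_le
    rw [rcvd_take_succ hj] at h2
    simp at h2
    omega
  have heq : sent p q (e.take (i + 1)) = rcvd p q (e.take (j + 1)) := by
    refine (List.prefix_of_prefix_length_le
      (filterMap_take_mono (sentMsg p q) e (show i + 1 ≤ j + 1 by omega)) hfj ?_).eq_of_length ?_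
    · change (sent p q (e.take (i + 1))).length ≤ _
      rw [sent_take_succ hi, rcvd_take_succ hj]; simp [h]
    · change (sent p q (e.take (i + 1))).length = _
      rw [sent_take_succ hi, rcvd_take_succ hj]; simp [h]
  have hm : m = m' := by
    have := heq
    rw [sent_take_succ hi, rcvd_take_succ hj] at this
    simpa using (List.append_inj' this rfl).2
  subst hm
  refine ⟨hij, (List.getElem?_eq_some_iff.1 hj).1, p, q, m, hi, hj, ?_⟩
  rw [← count_sent, ← count_rcvd, heq]

theorem IsFifo.exists_matches_of_recv {e : List (Act P M)} (he : IsFifo e) {j : ℕ} {p q : P}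
    {m : M} (hj : e[j]? = some (Act.recv p q m)) :
    ∃ i, Matches e i j ∧ (sent p q (e.take i)).length = (rcvd p q (e.take j)).length := by
  have h := (he p q (j + 1)).length_le
  rw [rcvd_take_succ hj] at h
  obtain ⟨i, _, m', hi, hn⟩ := exists_send_at (p := p) (q := q) (e := e)
    (n := (rcvd p q (e.take j)).length) (t := j + 1) (by simp at h; omega)
  exact ⟨i, he.matches_of_length_eq hi hj hn, hn⟩

theorem IsFifo.length_eq_of_matches {e : List (Act P M)} (he : IsFifo e) {i j : ℕ} {p q : P}
    {m : M} (h : Matches e i j) (hi : e[i]? = some (Act.send p q m)) :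
    (sent p q (e.take i)).length = (rcvd p q (e.take j)).length := by
  obtain ⟨i', h', hl⟩ := he.exists_matches_of_recv (h.recv_of_send hi)
  rwa [h'.eq_left h] at hl

theorem IsFifo.exists_matches_of_lt {e : List (Act P M)} (he : IsFifo e) {i t : ℕ} {p q : P}
    {m : M} (hi : e[i]? = some (Act.send p q m))
    (h : (sent p q (e.take i)).length < (rcvd p q (e.take t)).length) :
    ∃ j < t, Matches e i j := by
  obtain ⟨j, hj, m', hjr, hn⟩ := exists_recv_at h
  exact ⟨j, hj, he.matches_of_length_eq hi hjr hn.symm⟩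

/-- Matched sends of a channel are received in order, and no send overtakes an earlier one. -/
def DeliversInOrder (e : List (Act P M)) : Prop :=
  ∀ (i j j' : ℕ) (p q : P) (m m' : M), i < j → e[i]? = some (Act.send p q m) →
    e[j]? = some (Act.send p q m') → Matches e j j' → ∃ i' < j', Matches e i i'

theorem IsFifo.deliversInOrder {e : List (Act P M)} (he : IsFifo e) : DeliversInOrder e := by
  intro i j j' p q m m' hij hi hj h
  apply he.exists_matches_of_lt hi
  rw [← he.length_eq_of_matches h hj]
  exact sent_take_length_lt hi hij

theorem IsFifo.length_lt_iff_exists_unmatched {e : List (Act P M)} (he : IsFifo e) (p q : P) :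
    (rcvd p q e).length < (sent p q e).length ↔
      ∃ i m, e[i]? = some (Act.send p q m) ∧ ¬ MatchedSend e i := by
  constructor
  · intro h
    obtain ⟨i, _, m, hi, hn⟩ := exists_send_at (p := p) (q := q) (e := e)
      (n := (rcvd p q e).length) (t := e.length) (by simpa using h)
    refine ⟨i, m, hi, ?_⟩
    rintro ⟨j, hj⟩
    have h1 := he.length_eq_of_matches hj hi
    have h2 := rcvd_take_length_lt (hj.recv_of_send hi) hj.2.1
    rw [List.take_length] at h2
    omega
  · rintro ⟨i, m, hi, hu⟩
    by_contra hc
    have h1 := sent_take_length_lt hi (List.getElem?_eq_some_iff.1 hi).1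
    rw [List.take_length] at h1
    obtain ⟨j, _, hj⟩ := he.exists_matches_of_lt (t := e.length) hi (by
      rw [List.take_length]; omega)
    exact hu ⟨j, hj⟩

/-- In a well-formed sequence delivering in order, a receive takes the oldest pending message. -/
theorem DeliversInOrder.rcvd_perm_sent {e : List (Act P M)} (he : DeliversInOrder e)
    (hw : WFSeq e) {i j : ℕ} {p q : P} {m : M} (h : Matches e i j)
    (hi : e[i]? = some (Act.send p q m)) :
    (rcvd p q (e.take j)).Perm (sent p q (e.take i)) := by
  rw [List.perm_iff_count]
  intro m'
  rw [count_sent, count_rcvd]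
  apply le_antisymm
  · rcases Nat.eq_zero_or_pos ((e.take j).count (Act.recv p q m')) with h0 | h0
    · omega
    · obtain ⟨t, ht, hr, hc⟩ := exists_last_count h0
      obtain ⟨s, hs⟩ := hw t p q m' hr
      have hss := hs.send_of_recv hr
      have hsi : s < i := by
        rcases lt_trichotomy s i with hsi | rfl | hsi
        · exact hsi
        · have := hs.eq_right h; omega
        · obtain ⟨i', hi', hm⟩ := he i s t p q m m' hsi hi hss hs
          have := hm.eq_right h
          omega
      obtain ⟨_, _, p', q', m'', h1, h2, h3⟩ := hs
      rw [hr] at h2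
      obtain ⟨rfl, rfl, rfl⟩ : p = p' ∧ q = q' ∧ m' = m'' := by simpa using h2
      rw [← hc, ← h3]
      exact (List.take_prefix_take_left hsi).sublist.count_le _
  · rcases Nat.eq_zero_or_pos ((e.take i).count (Act.send p q m')) with h0 | h0
    · omega
    · obtain ⟨s, hsi, hss, hc⟩ := exists_last_count h0
      obtain ⟨t, ht, hs⟩ := he s i j p q m' m hsi hss hi h
      obtain ⟨_, _, p', q', m'', h1, h2, h3⟩ := hs
      rw [hss] at h1
      obtain ⟨rfl, rfl, rfl⟩ : p = p' ∧ q = q' ∧ m' = m'' := by simpa using h1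
      rw [← hc, h3]
      exact (List.take_prefix_take_left ht).sublist.count_le _

end Channels


/-! ## Peer-to-peer executions -/

section Executions
variable {P M St : Type} [DecidableEq P] [DecidableEq M] {S : CSystem P M St}

theorem P2PExecFrom.append {c c' c'' : (P → St) × (P → P → List M)} {e e' : List (Act P M)}
    (h : P2PExecFrom S c e c') (h' : P2PExecFrom S c' e' c'') :
    P2PExecFrom S c (e ++ e') c'' := by
  induction h with
  | nil => exact h'
  | cons hs _ ih => exact .cons hs (ih h')

theorem P2PExecFrom.of_append {e e' : List (Act P M)} {c c'' : (P → St) × (P → P → List M)}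
    (h : P2PExecFrom S c (e ++ e') c'') :
    ∃ c', P2PExecFrom S c e c' ∧ P2PExecFrom S c' e' c'' := by
  induction e generalizing c with
  | nil => exact ⟨c, .nil, h⟩
  | cons a e ih =>
    cases h with
    | cons hs h =>
      obtain ⟨c', h1, h2⟩ := ih h
      exact ⟨c', .cons hs h1, h2⟩

theorem P2PStep.buffer_eq {c c' : (P → St) × (P → P → List M)} {a : Act P M}
    (h : P2PStep S c a c') (p q : P) :
    c.2 p q ++ sent p q [a] = rcvd p q [a] ++ c'.2 p q := by
  cases h with
  | @send l b p' q' m l' hd =>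
    by_cases hpq : p = p' ∧ q = q'
    · obtain ⟨rfl, rfl⟩ := hpq
      simp [sent, rcvd, sentMsg, rcvdMsg]
    · have : ¬ (p' = p ∧ q' = q) := fun ⟨h1, h2⟩ => hpq ⟨h1.symm, h2.symm⟩
      simp [sent, rcvd, sentMsg, rcvdMsg, hpq, this]
  | @recv l b p' q' m l' rest hd hb =>
    by_cases hpq : p = p' ∧ q = q'
    · obtain ⟨rfl, rfl⟩ := hpq
      simp [sent, rcvd, sentMsg, rcvdMsg, hb]
    · have : ¬ (p' = p ∧ q' = q) := fun ⟨h1, h2⟩ => hpq ⟨h1.symm, h2.symm⟩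
      simp [sent, rcvd, sentMsg, rcvdMsg, hpq, this]

theorem P2PExecFrom.buffer_eq {c c' : (P → St) × (P → P → List M)} {e : List (Act P M)}
    (h : P2PExecFrom S c e c') (p q : P) :
    c.2 p q ++ sent p q e = rcvd p q e ++ c'.2 p q := by
  induction h with
  | nil => simp [sent, rcvd]
  | @cons c a c' e c'' hs _ ih =>
    have h1 : sent p q (a :: e) = sent p q [a] ++ sent p q e := by
      simp only [sent, ← List.filterMap_append, List.singleton_append]
    have h2 : rcvd p q (a :: e) = rcvd p q [a] ++ rcvd p q e := by
      simp only [rcvd, ← List.filterMap_append, List.singleton_append]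
    rw [h1, h2, ← List.append_assoc, hs.buffer_eq, List.append_assoc, ih, List.append_assoc]

theorem P2PExecFrom.sent_eq {l : P → St} {c' : (P → St) × (P → P → List M)}
    {e : List (Act P M)} (h : P2PExecFrom S (l, fun _ _ => []) e c') (p q : P) :
    sent p q e = rcvd p q e ++ c'.2 p q := by
  simpa using h.buffer_eq p q

theorem P2PExecFrom.isFifo {l : P → St} {c' : (P → St) × (P → P → List M)}
    {e : List (Act P M)} (h : P2PExecFrom S (l, fun _ _ => []) e c') : IsFifo e := by
  intro p q n
  rw [← List.take_append_drop n e] at h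
  obtain ⟨c, hc, -⟩ := h.of_append
  exact ⟨_, (hc.sent_eq p q).symm⟩

/-- Actions of `e` never receive from a channel whose buffer is non-empty in `b`. -/
def ReadsOnlyEmpty (b : P → P → List M) (e : List (Act P M)) : Prop :=
  ∀ (p q : P) (m : M), Act.recv p q m ∈ e → b p q = []

/-- Pending messages may be added at the head of all channels that are not read. -/
theorem P2PExecFrom.prepend {c c' : (P → St) × (P → P → List M)} {e : List (Act P M)}
    (h : P2PExecFrom S c e c') {d : P → P → List M} (hd : ReadsOnlyEmpty d e) :
    P2PExecFrom S (c.1, fun p q => d p q ++ c.2 p q) e (c'.1, fun p q => d p q ++ c'.2 p q) := by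
  induction h with
  | nil => exact .nil
  | @cons c a c' e c'' hs _ ih =>
    refine .cons ?_ (ih fun p q m hm => hd p q m (List.mem_cons_of_mem _ hm))
    cases hs with
    | @send l b p q m l' hl =>
      convert P2PStep.send (b := fun p q => d p q ++ b p q) hl using 2
      funext p' q'
      by_cases hpq : p' = p ∧ q' = q
      · obtain ⟨rfl, rfl⟩ := hpq
        simp
      · simp [hpq]
    | @recv l b p q m l' rest hl hb =>
      have h0 := hd p q m (by simp)
      convert P2PStep.recv (b := fun p q => d p q ++ b p q) (rest := rest) hl
        (by simp [h0, hb]) using 2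
      funext p' q'
      by_cases hpq : p' = p ∧ q' = q
      · obtain ⟨rfl, rfl⟩ := hpq
        simp [h0]
      · simp [hpq]

/-- Pending messages may be removed from the head of all channels that are not read. -/
theorem P2PExecFrom.exists_of_prepend {c c' : (P → St) × (P → P → List M)}
    {e : List (Act P M)} (h : P2PExecFrom S c e c') {d b : P → P → List M}
    (hd : ReadsOnlyEmpty d e) (hc : c.2 = fun p q => d p q ++ b p q) :
    ∃ b', P2PExecFrom S (c.1, b) e (c'.1, b') ∧ c'.2 = fun p q => d p q ++ b' p q := by
  induction h generalizing b with
  | nil => exact ⟨b, .nil, hc⟩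
  | @cons c a c' e c'' hs _ ih =>
    have hd' : ReadsOnlyEmpty d e := fun p q m hm => hd p q m (List.mem_cons_of_mem _ hm)
    cases hs with
    | @send l b₀ p q m l' hl =>
      simp only at hc
      subst hc
      obtain ⟨b', h1, h2⟩ := ih hd'
        (b := fun p' q' => if p' = p ∧ q' = q then b p q ++ [m] else b p' q') (by
          funext p' q'
          by_cases hpq : p' = p ∧ q' = q
          · obtain ⟨rfl, rfl⟩ := hpq
            simp
          · simp [hpq])
      exact ⟨b', .cons (.send hl) h1, h2⟩
    | @recv l b₀ p q m l' rest hl hb =>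
      have h0 := hd p q m (by simp)
      simp only at hc
      subst hc
      simp only [h0, List.nil_append] at hb
      obtain ⟨b', h1, h2⟩ := ih hd'
        (b := fun p' q' => if p' = p ∧ q' = q then rest else b p' q') (by
          funext p' q'
          by_cases hpq : p' = p ∧ q' = q
          · obtain ⟨rfl, rfl⟩ := hpq
            simp [h0]
          · simp [hpq])
      exact ⟨b', .cons (.recv hl hb) h1, h2⟩

/-- A run of the automaton of process `p`. -/
inductive LocalRun (S : CSystem P M St) (p : P) : St → List (Act P M) → St → Prop
  | nil {s} : LocalRun S p s [] s
  | cons {s a s' e s''} :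
      S.delta p s a s' → LocalRun S p s' e s'' → LocalRun S p s (a :: e) s''

/-- The actions of `e` performed by process `p`. -/
def localActs (p : P) (e : List (Act P M)) : List (Act P M) :=
  e.filter fun a => a.proc = p

theorem P2PStep.delta {c c' : (P → St) × (P → P → List M)} {a : Act P M}
    (h : P2PStep S c a c') :
    ∃ s', S.delta a.proc (c.1 a.proc) a s' ∧ c'.1 = Function.update c.1 a.proc s' := by
  cases h with
  | send hd => exact ⟨_, hd, rfl⟩
  | recv hd _ => exact ⟨_, hd, rfl⟩

theorem P2PExecFrom.localRun {c c' : (P → St) × (P → P → List M)} {e : List (Act P M)}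
    (h : P2PExecFrom S c e c') (p : P) : LocalRun S p (c.1 p) (localActs p e) (c'.1 p) := by
  induction h with
  | nil => exact .nil
  | @cons c a c' e c'' hs _ ih =>
    obtain ⟨s', hd, hc⟩ := hs.delta
    by_cases hp : a.proc = p
    · subst hp
      rw [hc, Function.update_self] at ih
      simpa [localActs] using LocalRun.cons hd ih
    · rw [hc, Function.update_of_ne (Ne.symm hp)] at ih
      simpa [localActs, hp] using ih

theorem exists_p2pExecFrom_append {c₀ : (P → St) × (P → P → List M)} {u w : List (Act P M)}
    {c : (P → St) × (P → P → List M)} (hu : P2PExecFrom S c₀ u c)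
    (hrun : ∀ p, ∃ s, LocalRun S p (c.1 p) (localActs p w) s)
    (hrecv : ∀ x y p q m c, u ++ w = x ++ Act.recv p q m :: y → P2PExecFrom S c₀ x c →
      ∃ rest, c.2 p q = m :: rest) :
    ∃ c', P2PExecFrom S c₀ (u ++ w) c' := by
  induction w generalizing u c with
  | nil => exact ⟨c, by simpa using hu⟩
  | cons a w ih =>
    obtain ⟨s', c', hs, hc, hrest⟩ : ∃ s' c', P2PStep S c a c' ∧
        c'.1 = Function.update c.1 a.proc s' ∧
        ∃ s, LocalRun S a.proc s' (localActs a.proc w) s := by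
      obtain ⟨s, hs⟩ := hrun a.proc
      simp only [localActs, List.filter_cons, decide_true, if_true] at hs
      cases hs with
      | cons hd hs =>
        cases a with
        | send p q m => exact ⟨_, _, .send (b := c.2) hd, rfl, s, hs⟩
        | recv p q m =>
          obtain ⟨rest, hr⟩ := hrecv u w p q m c rfl hu
          exact ⟨_, _, .recv (b := c.2) hd hr, rfl, s, hs⟩
    have happ : u ++ a :: w = (u ++ [a]) ++ w := by simp
    rw [happ]
    refine ih (hu.append (.cons hs .nil)) (fun p => ?_) (by rwa [← happ])
    by_cases hp : a.proc = p
    · subst hp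
      rwa [hc, Function.update_self]
    · rw [hc, Function.update_of_ne (Ne.symm hp)]
      simpa [localActs, hp] using hrun p

/-- Local runs of all processes and in-order delivery make `e` an execution. -/
theorem exists_p2pExecFrom_of_localRun {l : P → St} {e : List (Act P M)} (hw : WFSeq e)
    (hd : DeliversInOrder e) (hrun : ∀ p, ∃ s, LocalRun S p (l p) (localActs p e) s) :
    ∃ c, P2PExecFrom S (l, fun _ _ => []) e c := by
  refine exists_p2pExecFrom_append (u := []) (w := e) .nil hrun ?_
  rintro x y p q m c rfl hx
  have hj : (x ++ Act.recv p q m :: y)[x.length]? = some (Act.recv p q m) := by simp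
  obtain ⟨i, hi⟩ := hw _ p q m hj
  have his := hi.send_of_recv hj
  have hperm := (hd.rcvd_perm_sent hw hi his).length_eq
  have hix : i < x.length := hi.1
  rw [List.take_left] at hperm
  have hpre : sent p q ((x ++ Act.recv p q m :: y).take (i + 1)) <+: sent p q x := by
    have := filterMap_take_mono (sentMsg p q) (x ++ Act.recv p q m :: y)
      (show i + 1 ≤ x.length from hix)
    rwa [List.take_left] at this
  rw [sent_take_succ his] at hpre
  obtain ⟨z, hz⟩ := hpre
  rw [hx.sent_eq p q, List.append_assoc] at hz
  exact ⟨z, (List.append_inj hz hperm.symm).2.symm⟩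

end Executions

/-! ## Isomorphism of MSCs -/

section Isomorphism
variable {P M : Type}

theorem MSC.Iso.symm {m₁ m₂ : MSC P M} (h : m₁.Iso m₂) : m₂.Iso m₁ := by
  obtain ⟨f, hl, hp, hs⟩ := h
  refine ⟨f.symm, fun i => ?_, fun i j => ?_, fun i j => ?_⟩
  · simpa using (hl (f.symm i)).symm
  · simpa using (hp (f.symm i) (f.symm j)).symm
  · simpa using (hs (f.symm i) (f.symm j)).symm

theorem MSC.Iso.trans {m₁ m₂ m₃ : MSC P M} (h : m₁.Iso m₂) (h' : m₂.Iso m₃) : m₁.Iso m₃ := by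
  obtain ⟨f, hl, hp, hs⟩ := h
  obtain ⟨g, hl', hp', hs'⟩ := h'
  exact ⟨f.trans g, fun i => (hl' (f i)).trans (hl i),
    fun i j => (hp i j).trans (hp' (f i) (f j)), fun i j => (hs i j).trans (hs' (f i) (f j))⟩

variable [DecidableEq P] [DecidableEq M]

theorem Linearisation.iso {e e' : List (Act P M)} {m : MSC P M} (h : Linearisation e m)
    (h' : Linearisation e' m) : (mscOf e).Iso (mscOf e') :=
  h.2.trans h'.2.symm

theorem localActs_eq_map_get (p : P) (e : List (Act P M)) :
    localActs p e =
      ((List.finRange e.length).filter fun i => (e.get i).proc = p).map e.get := by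
  conv_lhs => rw [← List.map_get_finRange e]
  rw [localActs, List.filter_map]
  rfl

theorem localActs_eq_of_iso {e e' : List (Act P M)} (h : (mscOf e).Iso (mscOf e')) (p : P) :
    localActs p e = localActs p e' := by
  obtain ⟨f, hl, hpo, -⟩ := h
  change Fin e.length ≃ Fin e'.length at f
  have hl' : ∀ i, e'.get (f i) = e.get i := hl
  have hpo' : ∀ i j : Fin e.length, (i < j ∧ (e.get i).proc = (e.get j).proc) ↔
    (f i < f j ∧ (e'.get (f i)).proc = (e'.get (f j)).proc) := hpo
  rw [localActs_eq_map_get, localActs_eq_map_get]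
  set I := (List.finRange e.length).filter fun i => (e.get i).proc = p with hI
  set I' := (List.finRange e'.length).filter fun i => (e'.get i).proc = p with hI'
  have hsort : I.Pairwise (· < ·) := (List.pairwise_lt_finRange _).filter _
  have hsort' : I'.Pairwise (· < ·) := (List.pairwise_lt_finRange _).filter _
  have hmem : ∀ i ∈ I, (e.get i).proc = p := fun i hi => by simpa [hI] using hi
  have hfsort : (I.map f).Pairwise (· < ·) := by
    rw [List.pairwise_map]
    exact hsort.imp_of_mem fun {a b} ha hb hab =>
      ((hpo' a b).1 ⟨hab, (hmem a ha).trans (hmem b hb).symm⟩).1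
  have hperm : (I.map f).Perm I' := by
    rw [List.perm_ext_iff_of_nodup (hfsort.imp fun h => h.ne) (hsort'.imp fun h => h.ne)]
    intro a
    obtain ⟨b, rfl⟩ := f.surjective a
    have := hl' b
    simp only [List.get_eq_getElem] at this
    simp [hI, hI', this]
  have heq : I.map f = I' := hperm.eq_of_pairwise (fun a b _ _ h h' => absurd h h'.asymm)
    hfsort hsort'
  rw [← heq, List.map_map]
  exact List.map_congr_left fun i _ => (hl' i).symm

theorem mscOf_prec_lt {e : List (Act P M)} {i j : Fin (mscOf e).n} (h : (mscOf e).prec i j) :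
    i.val < j.val := by
  have hstep : ∀ i j : Fin (mscOf e).n, (mscOf e).po i j ∨ (mscOf e).src i j → i.val < j.val := by
    rintro i j (h | h)
    · exact h.1
    · exact h.1
  induction h with
  | single h => exact hstep _ _ h
  | tail _ h ih => exact ih.trans (hstep _ _ h)

theorem DeliversInOrder.p2pCausalDelivery {e : List (Act P M)} {m : MSC P M}
    (h : DeliversInOrder e) (hl : Linearisation e m) : P2PCausalDelivery m := by
  refine ⟨e, hl, fun i j p q v v' hij hi hj => ?_⟩
  by_cases hm : MatchedSend e j.val
  · right
    have hi' : e[i.val]? = some (Act.send p q v) := by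
      rw [← hi]; exact List.getElem?_eq_getElem i.isLt
    have hj' : e[j.val]? = some (Act.send p q v') := by
      rw [← hj]; exact List.getElem?_eq_getElem j.isLt
    obtain ⟨j', hjj⟩ := hm
    obtain ⟨i', hlt, hii⟩ := h i j j' p q v v' (mscOf_prec_lt hij) hi' hj' hjj
    refine ⟨⟨i', hii.2.1⟩, ⟨j', hjj.2.1⟩, hii, hjj, .single (.inl ⟨hlt, ?_⟩)⟩
    have h1 := hii.recv_of_send hi'
    have h2 := hjj.recv_of_send hj'
    rw [List.getElem?_eq_some_iff] at h1 h2
    obtain ⟨_, h1⟩ := h1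
    obtain ⟨_, h2⟩ := h2
    change (e[i']).proc = (e[j']).proc
    rw [h1, h2]
    rfl
  · exact .inl hm

theorem P2PCausalDelivery.deliversInOrder {e : List (Act P M)} {m : MSC P M}
    (h : P2PCausalDelivery m) (hl : Linearisation e m) : DeliversInOrder e := by
  obtain ⟨e', hl', hc⟩ := h
  obtain ⟨f, hlab, hpo, hsrc⟩ := hl.iso hl'
  intro i j j' p q v v' hij hi hj hm
  have hm' := hm.recv_of_send hj
  obtain ⟨li, hi⟩ := List.getElem?_eq_some_iff.1 hi
  obtain ⟨lj, hj⟩ := List.getElem?_eq_some_iff.1 hj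
  obtain ⟨lj', hm'⟩ := List.getElem?_eq_some_iff.1 hm'
  have hprec : (mscOf e').prec (f ⟨i, li⟩) (f ⟨j, lj⟩) :=
    .single (.inl ((hpo ⟨i, li⟩ ⟨j, lj⟩).1 ⟨hij, by
      change (e[i]).proc = (e[j]).proc
      rw [hi, hj]
      rfl⟩))
  have hmf : Matches e' (f ⟨j, lj⟩).val (f ⟨j', lj'⟩).val := (hsrc ⟨j, lj⟩ ⟨j', lj'⟩).1 hm
  rcases hc _ _ p q v v' hprec ((hlab ⟨i, li⟩).trans hi) ((hlab ⟨j, lj⟩).trans hj) with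
    hu | ⟨i', j'', h1, h2, h3⟩
  · exact absurd ⟨_, hmf⟩ hu
  · obtain ⟨i₀, rfl⟩ := f.surjective i'
    have hj'' : j'' = f ⟨j', lj'⟩ := Fin.ext (h2.eq_right hmf)
    subst hj''
    have hmi : Matches e i i₀.val := (hsrc ⟨i, li⟩ i₀).2 h1
    refine ⟨i₀.val, ?_, hmi⟩
    refine ((hpo i₀ ⟨j', lj'⟩).2 ⟨mscOf_prec_lt h3, ?_⟩).1
    have hr := hmi.recv_of_send (List.getElem?_eq_some_iff.2 ⟨li, hi⟩)
    obtain ⟨_, hr⟩ := List.getElem?_eq_some_iff.1 hr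
    have e1 : e'.get (f i₀) = Act.recv p q v := (hlab i₀).trans hr
    have e2 : e'.get (f ⟨j', lj'⟩) = Act.recv p q v' := (hlab ⟨j', lj'⟩).trans hm'
    rw [e1, e2]
    rfl

end Isomorphism


/-! ## Block-wise executions -/

section Blocks
variable {P M St : Type} [DecidableEq P] [DecidableEq M] {S : CSystem P M St}

/-- An execution by blocks, where each block reads only channels that are empty at its start. -/
inductive BlockRun (S : CSystem P M St) :
    ((P → St) × (P → P → List M)) → List (List (Act P M)) →
    ((P → St) × (P → P → List M)) → Prop
  | nil {c} : BlockRun S c [] c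
  | cons {c b c' es c''} :
      P2PExecFrom S c b c' → ReadsOnlyEmpty c.2 b → BlockRun S c' es c'' →
      BlockRun S c (b :: es) c''

theorem BlockRun.exec {c c' : (P → St) × (P → P → List M)} {es : List (List (Act P M))}
    (h : BlockRun S c es c') : P2PExecFrom S c es.flatten c' := by
  induction h with
  | nil => exact .nil
  | cons h _ _ ih => exact h.append ih

theorem BlockRun.split {es₁ es₂ : List (List (Act P M))} {b : List (Act P M)}
    {c c' : (P → St) × (P → P → List M)} (h : BlockRun S c (es₁ ++ b :: es₂) c') :
    ∃ c₁, P2PExecFrom S c es₁.flatten c₁ ∧ ReadsOnlyEmpty c₁.2 b := by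
  induction es₁ generalizing c with
  | nil =>
    cases h with
    | cons _ h _ => exact ⟨c, .nil, h⟩
  | cons b' es₁ ih =>
    cases h with
    | cons h _ h' =>
      obtain ⟨c₁, h1, h2⟩ := ih h'
      exact ⟨c₁, h.append h1, h2⟩

theorem BlockRun.of_exec {es : List (List (Act P M))} {c c' : (P → St) × (P → P → List M)}
    (h : P2PExecFrom S c es.flatten c')
    (hr : ∀ es₁ b es₂ c₁, es = es₁ ++ b :: es₂ → P2PExecFrom S c es₁.flatten c₁ →
      ReadsOnlyEmpty c₁.2 b) : BlockRun S c es c' := by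
  induction es generalizing c with
  | nil => cases h; exact .nil
  | cons b es ih =>
    obtain ⟨c₁, h1, h2⟩ := P2PExecFrom.of_append (e := b) (e' := es.flatten) (by simpa using h)
    refine .cons h1 (hr [] b es c rfl .nil) (ih h2 ?_)
    rintro es₁ b' es₂ c₂ rfl h3
    exact hr (b :: es₁) b' es₂ c₂ rfl (h1.append h3)

theorem blockStart_mono (es : List (List (Act P M))) {a b : ℕ} (h : a ≤ b) :
    blockStart es a ≤ blockStart es b :=
  ((List.take_prefix_take_left h).map _).sublist.sum_le_sum (by simp)

theorem blockStart_append_length (es₁ es₂ : List (List (Act P M))) :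
    blockStart (es₁ ++ es₂) es₁.length = es₁.flatten.length := by
  simp [blockStart, List.length_flatten]

theorem blockStart_append_length_succ (es₁ : List (List (Act P M))) (b : List (Act P M))
    (es₂ : List (List (Act P M))) :
    blockStart (es₁ ++ b :: es₂) (es₁.length + 1) = es₁.flatten.length + b.length := by
  have := blockStart_append_length (es₁ ++ [b]) es₂
  simpa using this

theorem exists_block_of_lt {es : List (List (Act P M))} {j : ℕ} (h : j < es.flatten.length) :
    ∃ es₁ b es₂, es = es₁ ++ b :: es₂ ∧ es₁.flatten.length ≤ j ∧
      j < es₁.flatten.length + b.length := by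
  induction es generalizing j with
  | nil => simp at h
  | cons b es ih =>
    by_cases hj : j < b.length
    · exact ⟨[], b, es, rfl, by simp, by simpa using hj⟩
    · obtain ⟨es₁, b', es₂, rfl, h1, h2⟩ := ih (j := j - b.length) (by
        simp only [List.flatten_cons, List.length_append] at h; omega)
      refine ⟨b :: es₁, b', es₂, rfl, ?_, ?_⟩ <;>
        simp only [List.flatten_cons, List.length_append] <;> omega

theorem BlockRun.sameBlock {es : List (List (Act P M))} {l : P → St}
    {c' : (P → St) × (P → P → List M)} (h : BlockRun S (l, fun _ _ => []) es c') {i j : ℕ}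
    (hm : Matches es.flatten i j) : SameBlock es i j := by
  have hfifo := h.exec.isFifo
  obtain ⟨es₁, b, es₂, rfl, h1, h2⟩ := exists_block_of_lt hm.2.1
  have hij := hm.1
  obtain ⟨_, _, p, q, m, hi, hj, _⟩ := id hm
  have hflat : (es₁ ++ b :: es₂).flatten = es₁.flatten ++ (b ++ es₂.flatten) := by simp
  have hs : es₁.flatten.length ≤ i := by
    by_contra hlt
    obtain ⟨c₁, hc₁, hr⟩ := h.split
    have hmem : Act.recv p q m ∈ b := by
      rw [hflat, List.getElem?_append_right h1, List.getElem?_append_left (by omega)] at hj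
      exact List.mem_of_getElem? hj
    have heq := hc₁.sent_eq p q
    rw [hr p q m hmem, List.append_nil] at heq
    have hlen := hfifo.length_eq_of_matches hm hi
    have hA := sent_take_length_lt hi (show i < es₁.flatten.length by omega)
    have hB := rcvd_take_length_mono p q (es₁ ++ b :: es₂).flatten h1
    have htake : (es₁ ++ b :: es₂).flatten.take es₁.flatten.length = es₁.flatten := by
      rw [hflat, List.take_left]
    rw [htake] at hA hB
    rw [heq] at hA
    omega
  refine ⟨es₁.length, by simp, ?_⟩
  rw [blockStart_append_length, blockStart_append_length_succ]
  omega

theorem BlockRun.of_sameBlock {es : List (List (Act P M))} {l : P → St}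
    {c' : (P → St) × (P → P → List M)} (h : P2PExecFrom S (l, fun _ _ => []) es.flatten c')
    (hs : ∀ i j, Matches es.flatten i j → SameBlock es i j) :
    BlockRun S (l, fun _ _ => []) es c' := by
  refine .of_exec h ?_
  rintro es₁ b es₂ c₁ rfl hc₁ p q m hmem
  have hfifo := h.isFifo
  have hflat : (es₁ ++ b :: es₂).flatten = es₁.flatten ++ (b ++ es₂.flatten) := by simp
  have htake : (es₁ ++ b :: es₂).flatten.take es₁.flatten.length = es₁.flatten := by
    rw [hflat, List.take_left]
  have htake' : (es₁ ++ b :: es₂).flatten.take (es₁.flatten.length + b.length) =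
      es₁.flatten ++ b := by
    rw [hflat, ← List.append_assoc, List.take_left' (by simp)]
  have hpos : 0 < (rcvd p q b).length := by
    rw [List.length_pos_iff_exists_mem]
    exact ⟨m, List.mem_filterMap.2 ⟨_, hmem, rcvdMsg_eq_some.2 rfl⟩⟩
  obtain ⟨j, hjlt, m', hj, hn⟩ := exists_recv_at (p := p) (q := q)
    (e := (es₁ ++ b :: es₂).flatten) (n := (rcvd p q es₁.flatten).length)
    (t := es₁.flatten.length + b.length) (by
      rw [htake', rcvd, rcvd, List.filterMap_append, List.length_append]
      exact Nat.lt_add_of_pos_right hpos)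
  have hjge : es₁.flatten.length ≤ j := by
    by_contra hlt
    have := rcvd_take_length_lt hj (not_le.1 hlt)
    rw [htake] at this
    omega
  obtain ⟨i, hm, hlen⟩ := hfifo.exists_matches_of_recv hj
  obtain ⟨β, _, h1, _, h2, h3⟩ := hs i j hm
  have hβ : es₁.length ≤ β := by
    by_contra hlt
    have := blockStart_mono (es₁ ++ b :: es₂) (show β + 1 ≤ es₁.length by omega)
    rw [blockStart_append_length] at this
    omega
  have hi : es₁.flatten.length ≤ i := by
    have := blockStart_mono (es₁ ++ b :: es₂) hβ
    rw [blockStart_append_length] at this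
    omega
  have hmono := sent_take_length_mono p q (es₁ ++ b :: es₂).flatten hi
  rw [htake, hc₁.sent_eq p q, List.length_append, hlen, hn] at hmono
  exact List.length_eq_zero_iff.1 (by omega)

end Blocks

/-! ## Abstract transitions -/

section Abstract
variable {P M St : Type} [DecidableEq P] [DecidableEq M] {S : CSystem P M St}

theorem mem_stageB {e : List (Act P M)} {B : P → Set P} {n : ℕ} {p q : P} :
    p ∈ stageB e B n q ↔
      p ∈ B q ∨ ∃ i < n, ∃ m, e[i]? = some (Act.send p q m) ∧ ¬ MatchedSend e i := by
  induction n with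
  | zero => simp [stageB]
  | succ n ih =>
    simp only [stageB, Set.mem_union, ih, Set.mem_ofPred_eq, or_assoc]
    refine or_congr_right ⟨?_, ?_⟩
    · rintro (⟨i, hi, h⟩ | h)
      · exact ⟨i, by omega, h⟩
      · exact ⟨n, by omega, h⟩
    · rintro ⟨i, hi, h⟩
      rcases Nat.lt_succ_iff_lt_or_eq.1 hi with hi | rfl
      · exact .inl ⟨i, hi, h⟩
      · exact .inr h

theorem mem_stageB_length_iff {l : P → St} {c' : (P → St) × (P → P → List M)}
    {e : List (Act P M)} (h : P2PExecFrom S (l, fun _ _ => []) e c') {B : P → Set P} {p q : P} :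
    p ∈ stageB e B e.length q ↔ p ∈ B q ∨ c'.2 p q ≠ [] := by
  rw [mem_stageB]
  refine or_congr_right ?_
  have h1 : c'.2 p q ≠ [] ↔ (rcvd p q e).length < (sent p q e).length := by
    rw [h.sent_eq p q, List.length_append, ← List.length_pos_iff]
    omega
  rw [h1, h.isFifo.length_lt_iff_exists_unmatched]
  constructor
  · rintro ⟨i, _, m, hi⟩
    exact ⟨i, m, hi⟩
  · rintro ⟨i, m, hi, hu⟩
    exact ⟨i, (List.getElem?_eq_some_iff.1 hi).1, m, hi, hu⟩

/-- `B q` is the set of processes with a pending message to `q`. -/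
def TracksPending (B : P → Set P) (b : P → P → List M) : Prop :=
  ∀ p q, p ∈ B q ↔ b p q ≠ []

theorem TracksPending.stageB {l : P → St} {b b' : P → P → List M} {e : List (Act P M)}
    {l' : P → St} {B : P → Set P} (hB : TracksPending B b)
    (h : P2PExecFrom S (l, fun _ _ => []) e (l', b')) :
    TracksPending (stageB e B e.length) (fun p q => b p q ++ b' p q) := by
  intro p q
  rw [mem_stageB_length_iff h, hB p q]
  simp only [ne_eq, List.append_eq_nil_iff]
  tauto

theorem P2PKExch.exec {k : ℕ} {e : List (Act P M)} {c c' : (P → St) × (P → Set P)}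
    (h : P2PKExch S k e c c') {b : P → P → List M} (hB : TracksPending c.2 b) :
    ∃ b', P2PExecFrom S (c.1, b) e (c'.1, b') ∧ ReadsOnlyEmpty b e ∧ TracksPending c'.2 b' := by
  obtain ⟨-, ⟨buf, hx⟩, hc', hm⟩ := h
  have hr : ReadsOnlyEmpty b e := by
    intro p q m hmem
    obtain ⟨j, hj⟩ := List.mem_iff_getElem?.1 hmem
    obtain ⟨i, hi, -⟩ := hx.isFifo.exists_matches_of_recv hj
    have := hm i p q m (hi.send_of_recv hj) ⟨j, hi⟩
    rw [mem_stageB, hB p q] at this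
    by_contra hne
    exact this (.inl hne)
  refine ⟨_, by simpa using hx.prepend hr, hr, ?_⟩
  rw [hc']
  exact hB.stageB hx

theorem P2PKExch.isBlock {k : ℕ} {e : List (Act P M)} {c c' : (P → St) × (P → Set P)}
    (h : P2PKExch S k e c c') : IsBlock k e := by
  obtain ⟨⟨ss, rs, he, hs, hr, h1, h2⟩, -⟩ := h
  exact ⟨ss, rs, he, hs, hr, h2, h1.trans h2⟩

theorem P2PKChain.isBlock {k : ℕ} {es : List (List (Act P M))} {c c' : (P → St) × (P → Set P)}
    (h : P2PKChain S k c es c') : ∀ b ∈ es, IsBlock k b := by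
  induction h with
  | nil => simp
  | cons h _ ih => exact List.forall_mem_cons.2 ⟨h.isBlock, ih⟩

theorem P2PKChain.blockRun {k : ℕ} {es : List (List (Act P M))} {c c' : (P → St) × (P → Set P)}
    (h : P2PKChain S k c es c') {b : P → P → List M} (hB : TracksPending c.2 b) :
    ∃ b', BlockRun S (c.1, b) es (c'.1, b') := by
  induction h generalizing b with
  | nil => exact ⟨b, .nil⟩
  | cons h _ ih =>
    obtain ⟨b₁, h1, h2, h3⟩ := h.exec hB
    obtain ⟨b', h'⟩ := ih h3
    exact ⟨b', .cons h1 h2 h'⟩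

variable [Fintype P]

theorem sum_sent_length {e : List (Act P M)} (h : ∀ a ∈ e, a.isSend) :
    ∑ x : P × P, (sent x.1 x.2 e).length = e.length := by
  induction e with
  | nil => simp [sent]
  | cons a e ih =>
    rw [List.forall_mem_cons] at h
    cases a with
    | recv p q m => exact h.1.elim
    | send p q m =>
      have : ∀ x : P × P, (sent x.1 x.2 (Act.send p q m :: e)).length =
          (sent x.1 x.2 e).length + if (p, q) = x then 1 else 0 := by
        rintro ⟨x, y⟩
        by_cases hxy : p = x ∧ q = y <;> simp [sent, sentMsg, hxy]
      simp only [this, Finset.sum_add_distrib, ih h.2]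
      simp

theorem sum_rcvd_length {e : List (Act P M)} (h : ∀ a ∈ e, a.isRecv) :
    ∑ x : P × P, (rcvd x.1 x.2 e).length = e.length := by
  induction e with
  | nil => simp [rcvd]
  | cons a e ih =>
    rw [List.forall_mem_cons] at h
    cases a with
    | send p q m => exact h.1.elim
    | recv p q m =>
      have : ∀ x : P × P, (rcvd x.1 x.2 (Act.recv p q m :: e)).length =
          (rcvd x.1 x.2 e).length + if (p, q) = x then 1 else 0 := by
        rintro ⟨x, y⟩
        by_cases hxy : p = x ∧ q = y <;> simp [rcvd, rcvdMsg, hxy]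
      simp only [this, Finset.sum_add_distrib, ih h.2]
      simp

theorem IsFifo.length_recvs_le {ss rs : List (Act P M)} (h : IsFifo (ss ++ rs))
    (hs : ∀ a ∈ ss, a.isSend) (hr : ∀ a ∈ rs, a.isRecv) : rs.length ≤ ss.length := by
  rw [← sum_sent_length hs, ← sum_rcvd_length hr]
  refine Finset.sum_le_sum fun x _ => ?_
  have hle := (h x.1 x.2 (ss ++ rs).length).length_le
  rw [List.take_length] at hle
  have h1 : sent x.1 x.2 rs = [] := by
    refine List.filterMap_eq_nil_iff.2 fun a ha => ?_
    have := hr a ha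
    cases a with
    | send => exact this.elim
    | recv => rfl
  have h2 : sent x.1 x.2 (ss ++ rs) = sent x.1 x.2 ss ++ sent x.1 x.2 rs :=
    List.filterMap_append
  have h3 : rcvd x.1 x.2 (ss ++ rs) = rcvd x.1 x.2 ss ++ rcvd x.1 x.2 rs :=
    List.filterMap_append
  rw [h2, h3, h1, List.append_nil, List.length_append] at hle
  omega

theorem exists_p2pKExch {k : ℕ} {e : List (Act P M)} {c c' : (P → St) × (P → P → List M)}
    (h : P2PExecFrom S c e c') (hr : ReadsOnlyEmpty c.2 e) (hb : IsBlock k e) {B : P → Set P}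
    (hB : TracksPending B c.2) :
    ∃ B', P2PKExch S k e (c.1, B) (c'.1, B') ∧ TracksPending B' c'.2 := by
  obtain ⟨b', hx, hc'⟩ := h.exists_of_prepend (b := fun _ _ => []) hr (by simp)
  refine ⟨stageB e B e.length, ⟨?_, ⟨b', hx⟩, rfl, ?_⟩, hc' ▸ hB.stageB hx⟩
  · obtain ⟨ss, rs, rfl, hs, hrs, hk, -⟩ := hb
    exact ⟨ss, rs, rfl, hs, hrs, hx.isFifo.length_recvs_le hs hrs, hk⟩
  · rintro i p q m hi ⟨j, hj⟩ hp
    rw [mem_stageB] at hp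
    rcases hp with hp | ⟨i₀, hlt, m', hi₀, hu⟩
    · exact (hB p q).1 hp (hr p q m (List.mem_of_getElem? (hj.recv_of_send hi)))
    · obtain ⟨j₀, _, hj₀⟩ := hx.isFifo.deliversInOrder i₀ i j p q m' m hlt hi₀ hi hj
      exact hu ⟨j₀, hj₀⟩

theorem BlockRun.exists_p2pKChain {k : ℕ} {es : List (List (Act P M))}
    {c c' : (P → St) × (P → P → List M)} (h : BlockRun S c es c')
    (hb : ∀ b ∈ es, IsBlock k b) {B : P → Set P} (hB : TracksPending B c.2) :
    ∃ B', P2PKChain S k (c.1, B) es (c'.1, B') := by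
  induction h generalizing B with
  | nil => exact ⟨B, .nil⟩
  | cons h hr _ ih =>
    rw [List.forall_mem_cons] at hb
    obtain ⟨B₁, h1, hB₁⟩ := exists_p2pKExch h hr hb.1 hB
    obtain ⟨B', h'⟩ := ih hb.2 hB₁
    exact ⟨B', .cons h1 h'⟩

end Abstract

theorem tracksPending_empty {P M : Type} :
    TracksPending (fun _ : P => (∅ : Set P)) (fun _ _ => ([] : List M)) :=
  fun _ _ => by simp


/-! ## Statement 14: an MSC is a k-synchronous MSC of the peer-to-peer system `S` iff
some linearisation of it is accepted by the peer-to-peer transition relation `⇝^e_k`. -/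

theorem p2p_ksync_msc_iff_kexchange_chain
    {P M St : Type} [Fintype P] [DecidableEq P] [Fintype M] [DecidableEq M] [Fintype St]
    (k : ℕ) (hk : 1 ≤ k) (S : CSystem P M St) (msc : MSC P M) :
    ((∃ e₀, p2pAsEx S e₀ ∧ Linearisation e₀ msc) ∧ P2PKSyncMSC k msc) ↔
      ∃ es : List (List (Act P M)), Linearisation es.flatten msc ∧
        ∃ c' : (P → St) × (P → Set P),
          P2PKChain S k (S.init, fun _ => (∅ : Set P)) es c' := by
  constructor
  · rintro ⟨⟨e₀, ⟨c₀, hx₀⟩, hl₀⟩, hcd, es, hl, hb, hs⟩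
    have hrun : ∀ p, ∃ s, LocalRun S p (S.init p) (localActs p es.flatten) s := fun p =>
      ⟨_, localActs_eq_of_iso (hl₀.iso hl) p ▸ hx₀.localRun p⟩
    obtain ⟨c, hx⟩ := exists_p2pExecFrom_of_localRun hl.1 (hcd.deliversInOrder hl) hrun
    obtain ⟨B', hB'⟩ := (BlockRun.of_sameBlock hx hs).exists_p2pKChain hb tracksPending_empty
    exact ⟨es, hl, _, hB'⟩
  · rintro ⟨es, hl, c', hc⟩
    obtain ⟨b', hx⟩ := hc.blockRun tracksPending_empty
    exact ⟨⟨es.flatten, ⟨_, hx.exec⟩, hl⟩, hx.exec.isFifo.deliversInOrder.p2pCausalDelivery hl,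
      es, hl, hc.isBlock, fun _ _ => hx.sameBlock⟩
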